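/- If C is a K-clustering of X that is strongly separable for N_p, then C is the unique strongly separable K-clustering of X for N_p: every K-clustering of X (with the same number K = |C| of clusters) that is strongly separable for N_p is equal to C. -/

import Mathlib

variable {α : Type*}

/-- Sparsity ε_{N_p}(x): smallest ε ≥ 0 such that at least N_p points of X lie within
distance ε of x. -/
noncomputable def sparsity [MetricSpace α] (X : Finset α) (Np : ℕ) (x : α) : ℝ :=
  sInf {ε : ℝ | 0 ≤ ε ∧ Np ≤ (X.filter (fun y => dist x y ≤ ε)).card}

/-- x is ε-connected to y: there is a finite sequence of points of X from x to y,
each of sparsity at most ε, with consecutive distances at most ε. -/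
def EpsConn [MetricSpace α] (X : Finset α) (Np : ℕ) (ε : ℝ) (x y : α) : Prop :=
  x ∈ X ∧ sparsity X Np x ≤ ε ∧
    Relation.ReflTransGen (fun a b => b ∈ X ∧ sparsity X Np b ≤ ε ∧ dist a b ≤ ε) x y

/-- A set c is ε-connected if every pair of points of c is ε-connected. -/
def SetConn [MetricSpace α] (X : Finset α) (Np : ℕ) (ε : ℝ) (c : Finset α) : Prop :=
  ∀ x ∈ c, ∀ y ∈ c, EpsConn X Np ε x y

/-- ε*(c): the minimum ε such that c is ε-connected. -/
noncomputable def setSparsity [MetricSpace α] (X : Finset α) (Np : ℕ) (c : Finset α) : ℝ :=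
  sInf {ε : ℝ | SetConn X Np ε c}

/-- ε(x,y): the minimum ε such that x is ε-connected to y. -/
noncomputable def epsDist [MetricSpace α] (X : Finset α) (Np : ℕ) (x y : α) : ℝ :=
  sInf {ε : ℝ | EpsConn X Np ε x y}

/-- ε(x,c): min over y ∈ c of ε(x,y). -/
noncomputable def ptClusterDist [MetricSpace α] (X : Finset α) (Np : ℕ) (x : α)
    (c : Finset α) : ℝ :=
  sInf {e : ℝ | ∃ y ∈ c, e = epsDist X Np x y}

/-- ε(c,c'): min over x ∈ c, y ∈ c' of ε(x,y). -/
noncomputable def clusterDist [MetricSpace α] (X : Finset α) (Np : ℕ)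
    (c c' : Finset α) : ℝ :=
  sInf {e : ℝ | ∃ x ∈ c, ∃ y ∈ c', e = epsDist X Np x y}

/-- A clustering of X: a partition of X into nonempty clusters. -/
def IsClustering (X : Finset α) (C : Finset (Finset α)) : Prop :=
  (∀ c ∈ C, c.Nonempty) ∧ (∀ c ∈ C, ∀ c' ∈ C, c ≠ c' → Disjoint c c') ∧
    (∀ c ∈ C, c ⊆ X) ∧ (∀ x ∈ X, ∃ c ∈ C, x ∈ c)

/-- C is weakly separable: for each cluster c, ε*(c) < min over c' ≠ c of ε(c,c'). -/
def WeaklySeparable [MetricSpace α] (X : Finset α) (Np : ℕ) (C : Finset (Finset α)) : Prop :=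
  ∀ c ∈ C, ∀ c' ∈ C, c' ≠ c → setSparsity X Np c < clusterDist X Np c c'

/-- c is an ε-cluster: a (nonempty) maximal ε-connected subset of X. -/
def IsEpsCluster [MetricSpace α] (X : Finset α) (Np : ℕ) (ε : ℝ) (c : Finset α) : Prop :=
  c.Nonempty ∧ SetConn X Np ε c ∧ ∀ x ∈ X, (∃ y ∈ c, EpsConn X Np ε x y) → x ∈ c

/-- c is a maximal cluster: an ε-cluster for some ε ≥ 0. -/
def IsMaximalCluster [MetricSpace α] (X : Finset α) (Np : ℕ) (c : Finset α) : Prop :=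
  ∃ ε : ℝ, 0 ≤ ε ∧ IsEpsCluster X Np ε c

/-- x is a local maximum: every y ∈ X with d(x,y) ≤ ε_{N_p}(x) has sparsity ≥ that of x. -/
def IsLocalMaxPt [MetricSpace α] (X : Finset α) (Np : ℕ) (x : α) : Prop :=
  x ∈ X ∧ ∀ y ∈ X, dist x y ≤ sparsity X Np x → sparsity X Np x ≤ sparsity X Np y

/-- X_c*: the points of c of minimum sparsity within c. -/
noncomputable def minSparsityPts [MetricSpace α] (X : Finset α) (Np : ℕ)
    (c : Finset α) : Finset α :=
  c.filter (fun x => ∀ y ∈ c, sparsity X Np x ≤ sparsity X Np y)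

/-- Relative separability A(x,y) = ε(x,y) / ε_{N_p}(x). -/
noncomputable def relSep [MetricSpace α] (X : Finset α) (Np : ℕ) (x y : α) : ℝ :=
  epsDist X Np x y / sparsity X Np x

/-- A(x,c) = min over y ∈ c of A(x,y). -/
noncomputable def relSepCluster [MetricSpace α] (X : Finset α) (Np : ℕ) (x : α)
    (c : Finset α) : ℝ :=
  sInf {a : ℝ | ∃ y ∈ c, a = relSep X Np x y}

/-- A^ℓ(C): the minimum A such that for every local maximum x, every y in the cluster of x
with sparsity at most that of x satisfies A(x,y) ≤ A. -/
noncomputable def Aell [MetricSpace α] (X : Finset α) (Np : ℕ)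
    (C : Finset (Finset α)) : ℝ :=
  sInf {A : ℝ | ∀ x ∈ X, IsLocalMaxPt X Np x → ∀ c ∈ C, x ∈ c →
    ∀ y ∈ c, sparsity X Np y ≤ sparsity X Np x → relSep X Np x y ≤ A}

/-- C is LM-separable: A^ℓ(C) < min over distinct clusters c, c' and z ∈ X_c* of A(z,c'). -/
def LMSeparable [MetricSpace α] (X : Finset α) (Np : ℕ) (C : Finset (Finset α)) : Prop :=
  ∀ c ∈ C, ∀ c' ∈ C, c ≠ c' → ∀ z ∈ minSparsityPts X Np c,
    Aell X Np C < relSepCluster X Np z c'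

/-- min over x ∈ c of ε_{N_p}(x). -/
noncomputable def minSpars [MetricSpace α] (X : Finset α) (Np : ℕ) (c : Finset α) : ℝ :=
  sInf (sparsity X Np '' (c : Set α))

/-- max over x ∈ c of ε_{N_p}(x). -/
noncomputable def maxSpars [MetricSpace α] (X : Finset α) (Np : ℕ) (c : Finset α) : ℝ :=
  sSup (sparsity X Np '' (c : Set α))

/-- C is strongly separable: there is an A such that each cluster c is
(A · min sparsity of c)-connected and A · min sparsity of c < min over c' ≠ c of ε(c,c'). -/
def StronglySeparable [MetricSpace α] (X : Finset α) (Np : ℕ)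
    (C : Finset (Finset α)) : Prop :=
  ∃ A : ℝ, ∀ c ∈ C, SetConn X Np (A * minSpars X Np c) c ∧
    ∀ c' ∈ C, c' ≠ c → A * minSpars X Np c < clusterDist X Np c c'

/-- c*(x,ε): the set of points of X that are ε-connected to x. -/
def epsClusterAt [MetricSpace α] (X : Finset α) (Np : ℕ) (ε : ℝ) (x : α) : Set α :=
  {y | EpsConn X Np ε x y}

section

variable {X : Finset α}

theorem IsClustering.eq_of_mem {C : Finset (Finset α)} (hC : IsClustering X C)
    {c d : Finset α} (hc : c ∈ C) (hd : d ∈ C) {x : α} (hxc : x ∈ c) (hxd : x ∈ d) : c = d := by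
  by_contra hne
  exact Finset.disjoint_left.mp (hC.2.1 c hc d hd hne) hxc hxd

/-- If each cluster of `C'` contains a cluster of `C`, and both clusterings have the same number
of clusters, then they are equal. -/
theorem IsClustering.eq_of_forall_exists_subset {C C' : Finset (Finset α)}
    (hC : IsClustering X C) (hC' : IsClustering X C') (hcard : C'.card = C.card)
    (h : ∀ c' ∈ C', ∃ c ∈ C, c ⊆ c') : C' = C := by
  choose! f hfC hf using h
  have hinj : Set.InjOn f C' := by
    intro a ha b hb hab
    obtain ⟨x, hx⟩ := hC.1 _ (hfC a ha)
    exact hC'.eq_of_mem ha hb (hf a ha hx) (hf b hb (hab ▸ hx))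
  have hsurj := Finset.surjOn_of_injOn_of_card_le f hfC hinj hcard.ge
  refine Finset.eq_of_subset_of_card_le (fun a ha => ?_) hcard.ge
  have hsub : a ⊆ f a := by
    intro y hy
    obtain ⟨c, hc, hyc⟩ := hC.2.2.2 y (hC'.2.2.1 a ha hy)
    obtain ⟨b, hb, rfl⟩ := hsurj hc
    rwa [hC'.eq_of_mem ha hb hy (hf b hb hyc)]
  exact (hsub.antisymm (hf a ha)) ▸ hfC a ha

variable [MetricSpace α] {Np : ℕ}

theorem sparsity_nonneg (x : α) : 0 ≤ sparsity X Np x :=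
  Real.sInf_nonneg fun _ h => h.1

theorem EpsConn.mono {ε δ : ℝ} (h : ε ≤ δ) {x y : α} (hxy : EpsConn X Np ε x y) :
    EpsConn X Np δ x y :=
  ⟨hxy.1, hxy.2.1.trans h, hxy.2.2.lift id
    fun _ _ hab => ⟨hab.1, hab.2.1.trans h, hab.2.2.trans h⟩⟩

theorem EpsConn.nonneg {ε : ℝ} {x y : α} (hxy : EpsConn X Np ε x y) : 0 ≤ ε :=
  (sparsity_nonneg x).trans hxy.2.1

theorem epsDist_nonneg (x y : α) : 0 ≤ epsDist X Np x y :=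
  Real.sInf_nonneg fun _ h => EpsConn.nonneg h

theorem EpsConn.epsDist_le {ε : ℝ} {x y : α} (hxy : EpsConn X Np ε x y) :
    epsDist X Np x y ≤ ε :=
  csInf_le ⟨0, fun _ h => EpsConn.nonneg h⟩ hxy

theorem clusterDist_le_epsDist {c c' : Finset α} {x y : α} (hx : x ∈ c) (hy : y ∈ c') :
    clusterDist X Np c c' ≤ epsDist X Np x y := by
  refine csInf_le ⟨0, ?_⟩ ⟨x, hx, y, hy, rfl⟩
  rintro _ ⟨a, -, b, -, rfl⟩
  exact epsDist_nonneg a b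

theorem minSpars_nonneg (c : Finset α) : 0 ≤ minSpars X Np c := by
  refine Real.sInf_nonneg ?_
  rintro _ ⟨x, -, rfl⟩
  exact sparsity_nonneg x

theorem minSpars_le {c : Finset α} {x : α} (hx : x ∈ c) :
    minSpars X Np c ≤ sparsity X Np x :=
  csInf_le (c.finite_toSet.image _).bddBelow ⟨x, hx, rfl⟩

theorem exists_sparsity_eq_minSpars {c : Finset α} (hc : c.Nonempty) :
    ∃ x ∈ c, sparsity X Np x = minSpars X Np c :=
  Set.Nonempty.csInf_mem (Set.Nonempty.image _ hc) (c.finite_toSet.image _)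

/-- Two clusterings with the same number of clusters, strongly separable with constants
`A ≤ A'`, are equal. -/
theorem eq_of_stronglySeparable_of_le {C C' : Finset (Finset α)} {A A' : ℝ} (hA : A ≤ A')
    (hC : IsClustering X C) (hC' : IsClustering X C') (hcard : C'.card = C.card)
    (hS : ∀ c ∈ C, SetConn X Np (A * minSpars X Np c) c)
    (hS' : ∀ c ∈ C', SetConn X Np (A' * minSpars X Np c) c ∧
      ∀ c' ∈ C', c' ≠ c → A' * minSpars X Np c < clusterDist X Np c c') : C' = C := by
  refine hC.eq_of_forall_exists_subset hC' hcard fun c' hc' => ?_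
  obtain ⟨x, hx, hxmin⟩ := exists_sparsity_eq_minSpars (X := X) (Np := Np) (hC'.1 c' hc')
  obtain ⟨c, hc, hxc⟩ := hC.2.2.2 x (hC'.2.2.1 c' hc' hx)
  have hle : minSpars X Np c ≤ minSpars X Np c' := hxmin ▸ minSpars_le hxc
  have hAle : A * minSpars X Np c ≤ A' * minSpars X Np c' := by
    have h0 := minSpars_nonneg (X := X) (Np := Np) c
    rcases (minSpars_nonneg (X := X) (Np := Np) c').eq_or_lt with h | h
    · have : minSpars X Np c = 0 := by linarith
      simp [this, ← h]
    · have hA' : 0 ≤ A' := nonneg_of_mul_nonneg_left ((hS' c' hc').1 x hx x hx).nonneg h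
      gcongr
  refine ⟨c, hc, fun y hy => ?_⟩
  obtain ⟨d, hd, hyd⟩ := hC'.2.2.2 y (hC.2.2.1 c hc hy)
  by_contra hyc'
  have hne : d ≠ c' := fun h => hyc' (h ▸ hyd)
  have hxy : EpsConn X Np (A' * minSpars X Np c') x y := (hS c hc x hxc y hy).mono hAle
  exact absurd ((hS' c' hc').2 d hd hne)
    (not_lt.mpr ((clusterDist_le_epsDist hx hyd).trans hxy.epsDist_le))

end

/-- a strongly separable K-clustering is the unique strongly separable
K-clustering. -/
theorem stmt_3 {α : Type*} [MetricSpace α] (X : Finset α) (Np : ℕ)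
    (hNp : 2 ≤ Np) (hNpX : Np ≤ X.card)
    (C C' : Finset (Finset α))
    (hC : IsClustering X C) (hS : StronglySeparable X Np C)
    (hC' : IsClustering X C') (hcard : C'.card = C.card)
    (hS' : StronglySeparable X Np C') :
    C' = C := by
  obtain ⟨A, hA⟩ := hS
  obtain ⟨A', hA'⟩ := hS'
  rcases le_total A A' with h | h
  · exact eq_of_stronglySeparable_of_le h hC hC' hcard (fun c hc => (hA c hc).1) hA'
  · exact (eq_of_stronglySeparable_of_le h hC' hC hcard.symm (fun c hc => (hA' c hc).1) hA).symm
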